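/- arXiv:1802.09340 — 6 statements merged into one kernel-verified Lean document; each statement's English description precedes it below -/
import Mathlib

section
/- There exists a magic knight's tour of the 4×18 board: a knight's tour in which each of the four 18-cell rows sums to 657 and each of the eighteen 4-cell columns sums to 146. -/
/-- Two cells are a knight's move apart: coordinate differences in absolute
value are {1,2}. -/
def knightMove {m n : ℕ} (a b : Fin m × Fin n) : Prop :=
  (((a.1.val : ℤ) - b.1.val).natAbs = 1 ∧ ((a.2.val : ℤ) - b.2.val).natAbs = 2) ∨
  (((a.1.val : ℤ) - b.1.val).natAbs = 2 ∧ ((a.2.val : ℤ) - b.2.val).natAbs = 1)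

/-- A knight's tour of the m×n board: a bijective numbering (as an equiv from
`Fin (m*n)`, representing the numbers 1,…,m·n) of the cells, such that
consecutive numbers occupy cells a knight's move apart. -/
def IsKnightTour (m n : ℕ) (t : Fin (m * n) ≃ Fin m × Fin n) : Prop :=
  ∀ (k : ℕ) (h : k + 1 < m * n),
    knightMove (t ⟨k, Nat.lt_of_succ_lt h⟩) (t ⟨k + 1, h⟩)

/-- The number (in 1,…,m·n) assigned to a cell by the tour. -/
def cellNum {m n : ℕ} (t : Fin (m * n) ≃ Fin m × Fin n) (c : Fin m × Fin n) : ℕ :=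
  (t.symm c).val + 1

/-- The sum of the numbers in row `i` (an n-cell line). -/
def rowSum {m n : ℕ} (t : Fin (m * n) ≃ Fin m × Fin n) (i : Fin m) : ℕ :=
  ∑ j : Fin n, cellNum t (i, j)

/-- The sum of the numbers in column `j` (an m-cell line). -/
def colSum {m n : ℕ} (t : Fin (m * n) ≃ Fin m × Fin n) (j : Fin n) : ℕ :=
  ∑ i : Fin m, cellNum t (i, j)

/-- The cells of a magic knight's tour of the 4×18 board, in the order of the tour. -/
def magicTourCell : Fin (4 * 18) → Fin 4 × Fin 18 :=
  ![(3, 1), (1, 0), (0, 2), (2, 3), (0, 4), (2, 5), (3, 7), (1, 8), (3, 9),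
    (1, 10), (3, 11), (1, 12), (0, 14), (2, 13), (0, 12), (1, 14), (0, 16), (2, 17),
    (3, 15), (1, 16), (3, 17), (2, 15), (3, 13), (2, 11), (0, 10), (2, 9), (0, 8),
    (1, 6), (3, 5), (2, 7), (0, 6), (1, 4), (3, 3), (1, 2), (0, 0), (2, 1),
    (1, 3), (0, 1), (2, 0), (3, 2), (2, 4), (3, 6), (1, 7), (0, 5), (2, 6),
    (3, 8), (2, 10), (0, 9), (1, 11), (0, 13), (1, 15), (0, 17), (2, 16), (0, 15),
    (1, 17), (3, 16), (2, 14), (3, 12), (1, 13), (3, 14), (2, 12), (0, 11), (1, 9),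
    (3, 10), (2, 8), (0, 7), (1, 5), (3, 4), (2, 2), (3, 0), (1, 1), (0, 3)]

/-- The numbers of a magic knight's tour of the 4×18 board, row by row. -/
def magicTourNumber : Fin 4 → Fin 18 → ℕ :=
  ![![35, 38, 3, 72, 5, 44, 31, 66, 27, 48, 25, 62, 15, 50, 13, 54, 17, 52],
    ![2, 71, 34, 37, 32, 67, 28, 43, 8, 63, 10, 49, 12, 59, 16, 51, 20, 55],
    ![39, 36, 69, 4, 41, 6, 45, 30, 65, 26, 47, 24, 61, 14, 57, 22, 53, 18],
    ![70, 1, 40, 33, 68, 29, 42, 7, 46, 9, 64, 11, 58, 23, 60, 19, 56, 21]]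

/-- A magic knight's tour of the 4×18 board; its inverse is read off from `magicTourNumber`. -/
def magicTour : Fin (4 * 18) ≃ Fin 4 × Fin 18 where
  toFun := magicTourCell
  invFun c := Fin.ofNat (4 * 18) (magicTourNumber c.1 c.2 - 1)
  left_inv := by unfold Function.LeftInverse; decide +kernel
  right_inv := by unfold Function.RightInverse Function.LeftInverse; decide +kernel

instance {m n : ℕ} (a b : Fin m × Fin n) : Decidable (knightMove a b) := by
  unfold knightMove
  infer_instance

lemma isKnightTour_magicTour : IsKnightTour 4 18 magicTour := by
  have h : ∀ k : Fin 71, knightMove (magicTour k.castSucc) (magicTour k.succ) := by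
    decide +kernel
  exact fun k hk ↦ h ⟨k, Nat.lt_of_succ_lt_succ hk⟩

lemma rowSum_magicTour : ∀ i : Fin 4, rowSum magicTour i = 657 := by
  decide +kernel

lemma colSum_magicTour : ∀ j : Fin 18, colSum magicTour j = 146 := by
  decide +kernel

/-- There exists a magic knight's tour of the 4×18 board. -/
theorem magic_tour_4x18 :
    ∃ t : Fin (4 * 18) ≃ Fin 4 × Fin 18, IsKnightTour 4 18 t ∧
      (∀ i : Fin 4, rowSum t i = 657) ∧ (∀ j : Fin 18, colSum t j = 146) := by
  exact ⟨magicTour, isKnightTour_magicTour, rowSum_magicTour, colSum_magicTour⟩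
end

section
/- There exist at least 16 pairwise distinct magic knight's tours of the 4×18 board, i.e. at least 16 distinct bijective numberings each of which is a knight's tour with all four 18-cell rows summing to 657 and all eighteen 4-cell columns summing to 146. -/
instance inst_s3 {m n : ℕ} (a b : Fin m × Fin n) : Decidable (knightMove a b) :=
  inferInstanceAs (Decidable (_ ∨ _))

theorem rowSum_eq_sum_ite {m n : ℕ} (t : Fin (m * n) ≃ Fin m × Fin n) (i : Fin m) :
    rowSum t i = ∑ k, if (t k).1 = i then k.val + 1 else 0 := by
  rw [← t.symm.sum_comp, Fintype.sum_prod_type]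
  simp [rowSum, cellNum]

theorem colSum_eq_sum_ite {m n : ℕ} (t : Fin (m * n) ≃ Fin m × Fin n) (j : Fin n) :
    colSum t j = ∑ k, if (t k).2 = j then k.val + 1 else 0 := by
  rw [← t.symm.sum_comp, Fintype.sum_prod_type_right]
  simp [colSum, cellNum]

/-- The successive columns visited by four magic tours of the 4×18 board. -/
def tourColumns : Fin 4 → List (Fin 18) :=
  ![[16, 17, 15, 14, 13, 12, 10, 9, 7, 8, 6, 5, 3, 4, 5, 3, 1, 0,
     2, 1, 0, 2, 4, 6, 8, 7, 9, 11, 12, 10, 11, 13, 14, 15, 17, 16,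
     14, 16, 17, 15, 13, 11, 10, 12, 11, 9, 8, 7, 6, 4, 2, 0, 1, 2,
     0, 1, 3, 5, 4, 3, 5, 6, 7, 8, 9, 10, 12, 13, 15, 17, 16, 14],
    [14, 16, 17, 15, 13, 12, 10, 9, 8, 7, 6, 5, 3, 4, 5, 3, 1, 0,
     2, 1, 0, 2, 4, 6, 7, 8, 9, 11, 12, 10, 11, 13, 15, 17, 16, 14,
     16, 17, 15, 14, 13, 11, 10, 12, 11, 9, 7, 8, 6, 4, 2, 0, 1, 2,
     0, 1, 3, 5, 4, 3, 5, 6, 8, 7, 9, 10, 12, 13, 14, 15, 17, 16],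
    [16, 17, 15, 14, 13, 12, 10, 9, 8, 7, 6, 5, 3, 4, 5, 3, 1, 0,
     2, 1, 0, 2, 4, 6, 7, 8, 9, 11, 12, 10, 11, 13, 14, 15, 17, 16,
     14, 16, 17, 15, 13, 11, 10, 12, 11, 9, 7, 8, 6, 4, 2, 0, 1, 2,
     0, 1, 3, 5, 4, 3, 5, 6, 8, 7, 9, 10, 12, 13, 15, 17, 16, 14],
    [14, 16, 17, 15, 13, 12, 10, 9, 7, 8, 6, 5, 3, 4, 5, 3, 1, 0,
     2, 1, 0, 2, 4, 6, 8, 7, 9, 11, 12, 10, 11, 13, 15, 17, 16, 14,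
     16, 17, 15, 14, 13, 11, 10, 12, 11, 9, 8, 7, 6, 4, 2, 0, 1, 2,
     0, 1, 3, 5, 4, 3, 5, 6, 7, 8, 9, 10, 12, 13, 14, 15, 17, 16]]

/-- The cell visited at step `k`. The tour alternates between outer and inner rows, except for one
move between the two inner rows after 36 cells, so the column and its parity determine the row. -/
def baseCell (w : Fin 4) (k : Fin (4 * 18)) : Fin 4 × Fin 18 :=
  let c := (tourColumns w).getD k.val 0
  let half := k.val / 36
  (if (k.val + half) % 2 = 0 then
    if (c.val + half) % 2 = 0 then 0 else 3
  else
    if (c.val + half) % 2 = 0 then 1 else 2, c)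

theorem baseCell_injective : ∀ w, Function.Injective (baseCell w) := by
  decide +kernel

/-- The tour listed in `tourColumns w`. -/
noncomputable def baseTour (w : Fin 4) : Fin (4 * 18) ≃ Fin 4 × Fin 18 :=
  Equiv.ofBijective (baseCell w) <|
    (Fintype.bijective_iff_injective_and_card _).2 ⟨baseCell_injective w, by simp⟩

/-- Reversal of the coordinate of `Fin n` when `b` is true. -/
def flipIf (n : ℕ) (b : Bool) : Equiv.Perm (Fin n) :=
  if b then Fin.revPerm else 1

/-- The reflections of the board selected by `s`, applied to a cell. -/
def reflectedCell (s : Fin 4 × Bool × Bool) (k : Fin (4 * 18)) : Fin 4 × Fin 18 :=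
  (baseCell s.1 k).map (flipIf 4 s.2.1) (flipIf 18 s.2.2)

/-- The tour `baseTour s.1` after the reflections of the board selected by `s`. -/
noncomputable def reflectedTour (s : Fin 4 × Bool × Bool) : Fin (4 * 18) ≃ Fin 4 × Fin 18 :=
  (baseTour s.1).trans ((flipIf 4 s.2.1).prodCongr (flipIf 18 s.2.2))

theorem reflectedTour_apply (s : Fin 4 × Bool × Bool) (k : Fin (4 * 18)) :
    reflectedTour s k = reflectedCell s k :=
  rfl

theorem reflectedTour_injective : Function.Injective reflectedTour := by
  have key : ∀ s s', (∀ k, reflectedCell s k = reflectedCell s' k) → s = s' := by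
    decide +kernel
  intro s s' h
  exact key s s' fun k => by rw [← reflectedTour_apply, h, reflectedTour_apply]

theorem isKnightTour_reflectedTour (s : Fin 4 × Bool × Bool) :
    IsKnightTour 4 18 (reflectedTour s) := by
  have key : ∀ s, ∀ k : Fin 71, knightMove (reflectedCell s ⟨k.val, by omega⟩)
      (reflectedCell s ⟨k.val + 1, by omega⟩) := by
    decide +kernel
  exact fun k h => key s ⟨k, by omega⟩

theorem rowSum_reflectedTour (s : Fin 4 × Bool × Bool) (i : Fin 4) :
    rowSum (reflectedTour s) i = 657 := by
  have key : ∀ s i, (∑ k, if (reflectedCell s k).1 = i then k.val + 1 else 0) = 657 := by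
    decide +kernel
  rw [rowSum_eq_sum_ite]
  exact key s i

theorem colSum_reflectedTour (s : Fin 4 × Bool × Bool) (j : Fin 18) :
    colSum (reflectedTour s) j = 146 := by
  have key : ∀ s j, (∑ k, if (reflectedCell s k).2 = j then k.val + 1 else 0) = 146 := by
    decide +kernel
  rw [colSum_eq_sum_ite]
  exact key s j

/-- There exist at least 16 pairwise distinct magic knight's tours of the
4×18 board. -/
theorem sixteen_magic_tours_4x18 :
    ∃ f : Fin 16 → (Fin (4 * 18) ≃ Fin 4 × Fin 18), Function.Injective f ∧
      ∀ a : Fin 16, IsKnightTour 4 18 (f a) ∧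
        (∀ i : Fin 4, rowSum (f a) i = 657) ∧
        (∀ j : Fin 18, colSum (f a) j = 146) := by
  let e : Fin 16 ≃ Fin 4 × Bool × Bool := Fintype.equivOfCardEq (by simp)
  exact ⟨reflectedTour ∘ e, reflectedTour_injective.comp e.injective, fun a =>
    ⟨isKnightTour_reflectedTour _, rowSum_reflectedTour _, colSum_reflectedTour _⟩⟩
end

section
/- There exists a quasi-magic knight's tour of the 6×8 board with the 8-cell lines magic: a knight's tour in which each of the six 8-cell lines sums to the magic constant 196, and the eight 6-cell lines take exactly two distinct sum values. -/
/-- The grid of numbers, shifted to start at `0`, of a quasi-magic tour of the 6×8 board. The numbers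
`k` and `37 - k` for `1 ≤ k ≤ 12`, and `k` and `61 - k` for `13 ≤ k ≤ 24`, occupy cells that are
mirror images under the reflection `j ↦ 7 - j` of the columns. -/
def quasiMagicGrid : Fin 6 → Fin 8 → Fin 48 :=
  ![![43, 26, 1, 18, 41, 34, 9, 16],
    ![0, 19, 42, 27, 8, 17, 40, 35],
    ![25, 44, 23, 2, 33, 36, 15, 10],
    ![20, 3, 28, 47, 12, 7, 32, 39],
    ![45, 24, 5, 22, 37, 30, 11, 14],
    ![4, 21, 46, 29, 6, 13, 38, 31]]

/-- The cells visited by the tour with numbers `quasiMagicGrid`, in order. -/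
def quasiMagicPath : Fin 48 → Fin 6 × Fin 8 :=
  ![(1, 0), (0, 2), (2, 3), (3, 1), (5, 0), (4, 2), (5, 4), (3, 5),
    (1, 4), (0, 6), (2, 7), (4, 6), (3, 4), (5, 5), (4, 7), (2, 6),
    (0, 7), (1, 5), (0, 3), (1, 1), (3, 0), (5, 1), (4, 3), (2, 2),
    (4, 1), (2, 0), (0, 1), (1, 3), (3, 2), (5, 3), (4, 5), (5, 7),
    (3, 6), (2, 4), (0, 5), (1, 7), (2, 5), (4, 4), (5, 6), (3, 7),
    (1, 6), (0, 4), (1, 2), (0, 0), (2, 1), (4, 0), (5, 2), (3, 3)]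

/-- The tour of the 6×8 board with numbers `quasiMagicGrid`. -/
def quasiMagicTour : Fin (6 * 8) ≃ Fin 6 × Fin 8 where
  toFun := quasiMagicPath
  invFun c := quasiMagicGrid c.1 c.2
  left_inv := by decide
  right_inv := by decide

theorem isKnightTour_quasiMagicTour : IsKnightTour 6 8 quasiMagicTour := by
  have key : ∀ k : Fin 47, knightMove (quasiMagicPath k.castSucc) (quasiMagicPath k.succ) := by
    unfold knightMove
    decide
  exact fun k h => key ⟨k, by omega⟩

/-- There exists a quasi-magic knight's tour of the 6×8 board: every
8-cell line (row) sums to the magic constant 196, and the 6-cell lines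
(columns) take exactly two distinct sum values. -/
theorem quasi_magic_6x8_rows :
    ∃ t : Fin (6 * 8) ≃ Fin 6 × Fin 8, IsKnightTour 6 8 t ∧
      (∀ i : Fin 6, rowSum t i = 196) ∧
      ∃ a b : ℕ, a ≠ b ∧ (∀ j : Fin 8, colSum t j = a ∨ colSum t j = b) ∧
        (∃ j : Fin 8, colSum t j = a) ∧ (∃ j : Fin 8, colSum t j = b) := by
  exact ⟨quasiMagicTour, isKnightTour_quasiMagicTour, by decide, 143, 151, by decide, by decide,
    by decide, by decide⟩
end

section
/- There exists a semi-magic knight's tour of the 6×6 board: a knight's tour in which each of the six lines in one direction (each a 6-cell line) sums to the magic constant 111. -/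
/-- The cell visited at each step of a knight's tour of the 6×6 board. -/
def tourCell : Fin (6 * 6) → Fin 6 × Fin 6 :=
  ![(1, 2), (0, 0), (2, 1), (4, 2), (5, 0), (3, 1),
    (1, 0), (0, 2), (1, 4), (3, 5), (5, 4), (3, 3),
    (4, 5), (5, 3), (4, 1), (2, 0), (0, 1), (2, 2),
    (3, 4), (5, 5), (4, 3), (2, 4), (0, 5), (1, 3),
    (2, 5), (0, 4), (2, 3), (4, 4), (5, 2), (4, 0),
    (3, 2), (5, 1), (3, 0), (1, 1), (0, 3), (1, 5)]

/-- The step (counted from 0) at which each cell of the 6×6 board is visited. -/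
def tourStep : Fin 6 → Fin 6 → Fin (6 * 6) :=
  ![![1, 16, 7, 34, 25, 22],
    ![6, 33, 0, 23, 8, 35],
    ![15, 2, 17, 26, 21, 24],
    ![32, 5, 30, 11, 18, 9],
    ![29, 14, 3, 20, 27, 12],
    ![4, 31, 28, 13, 10, 19]]

/-- A knight's tour of the 6×6 board all of whose rows have the same sum. -/
def semiMagicTour : Fin (6 * 6) ≃ Fin 6 × Fin 6 where
  toFun := tourCell
  invFun c := tourStep c.1 c.2
  left_inv := by unfold Function.LeftInverse; decide
  right_inv := by unfold Function.RightInverse Function.LeftInverse; decide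

theorem isKnightTour_semiMagicTour : IsKnightTour 6 6 semiMagicTour := by
  have key : ∀ k : Fin 35, knightMove (tourCell k.castSucc) (tourCell k.succ) := by
    unfold knightMove
    decide
  exact fun k h => key ⟨k, Nat.lt_of_succ_lt_succ h⟩

theorem rowSum_semiMagicTour (i : Fin 6) : rowSum semiMagicTour i = 111 := by
  revert i
  decide

/-- There exists a semi-magic knight's tour of the 6×6 board: all six lines in
one direction sum to the magic constant 111. -/
theorem semi_magic_tour_6x6 :
    ∃ t : Fin (6 * 6) ≃ Fin 6 × Fin 6, IsKnightTour 6 6 t ∧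
      ((∀ i : Fin 6, rowSum t i = 111) ∨ (∀ j : Fin 6, colSum t j = 111)) := by
  exact ⟨semiMagicTour, isKnightTour_semiMagicTour, Or.inl rowSum_semiMagicTour⟩
end

section
/- There exist at least 3 pairwise distinct magic emperor tours of the 4×6 board: bijective numberings of the 24 cells by 1,…,24 in which consecutive numbers occupy cells an emperor's move apart, every 6-cell line sums to 75, and every 4-cell line sums to 50. -/
/-- A wazir move: a single orthogonal step. -/
def wazirMove {m n : ℕ} (a b : Fin m × Fin n) : Prop :=
  (((a.1.val : ℤ) - b.1.val).natAbs = 0 ∧ ((a.2.val : ℤ) - b.2.val).natAbs = 1) ∨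
  (((a.1.val : ℤ) - b.1.val).natAbs = 1 ∧ ((a.2.val : ℤ) - b.2.val).natAbs = 0)

/-- An emperor's move: a knight's move or a wazir move. -/
def emperorMove {m n : ℕ} (a b : Fin m × Fin n) : Prop :=
  knightMove a b ∨ wazirMove a b

/-- An emperor tour of the m×n board: a bijective numbering of the cells such
that consecutive numbers occupy cells an emperor's move apart. -/
def IsEmperorTour (m n : ℕ) (t : Fin (m * n) ≃ Fin m × Fin n) : Prop :=
  ∀ (k : ℕ) (h : k + 1 < m * n),
    emperorMove (t ⟨k, Nat.lt_of_succ_lt h⟩) (t ⟨k + 1, h⟩)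

/-- The cells of three magic emperor tours of the 4×6 board, in visiting order. -/
def magicEmperorPath : Fin 3 → Fin 24 → Fin 4 × Fin 6 :=
  ![
    ![(0, 0), (0, 1), (1, 1), (2, 3), (3, 5), (3, 4), (3, 3), (1, 2),
      (2, 0), (3, 2), (2, 4), (2, 5), (1, 5), (1, 4), (0, 2), (1, 0),
      (2, 2), (0, 3), (0, 4), (0, 5), (1, 3), (2, 1), (3, 1), (3, 0)],
    ![(0, 0), (0, 1), (1, 3), (2, 5), (3, 3), (3, 4), (3, 5), (1, 4),
      (2, 2), (3, 2), (2, 0), (2, 1), (1, 1), (1, 0), (0, 2), (1, 2),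
      (2, 4), (0, 5), (0, 4), (0, 3), (1, 5), (2, 3), (3, 1), (3, 0)],
    ![(0, 0), (0, 1), (1, 3), (2, 5), (3, 5), (3, 4), (2, 4), (3, 2),
      (3, 3), (1, 2), (1, 1), (1, 0), (2, 0), (2, 1), (2, 2), (0, 3),
      (0, 2), (1, 4), (0, 4), (0, 5), (1, 5), (2, 3), (3, 1), (3, 0)]]

/-- The numberings of the cells, from 1 to 24, inverse to `magicEmperorPath`. -/
def magicEmperorSquare : Fin 3 → Fin 4 → Fin 6 → ℕ :=
  ![
    ![![1, 2, 15, 18, 19, 20],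
      ![16, 3, 8, 21, 14, 13],
      ![9, 22, 17, 4, 11, 12],
      ![24, 23, 10, 7, 6, 5]],
    ![![1, 2, 15, 20, 19, 18],
      ![14, 13, 16, 3, 8, 21],
      ![11, 12, 9, 22, 17, 4],
      ![24, 23, 10, 5, 6, 7]],
    ![![1, 2, 17, 16, 19, 20],
      ![12, 11, 10, 3, 18, 21],
      ![13, 14, 15, 22, 7, 4],
      ![24, 23, 8, 9, 6, 5]]]

theorem magicEmperorSquare_pos (a : Fin 3) (i : Fin 4) (j : Fin 6) :
    1 ≤ magicEmperorSquare a i j := by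
  revert a i j; decide

theorem magicEmperorSquare_le (a : Fin 3) (i : Fin 4) (j : Fin 6) :
    magicEmperorSquare a i j ≤ 24 := by
  revert a i j; decide

/-- The tour following `magicEmperorPath a`. -/
def magicEmperorTour (a : Fin 3) : Fin (4 * 6) ≃ Fin 4 × Fin 6 where
  toFun := magicEmperorPath a
  invFun c := ⟨magicEmperorSquare a c.1 c.2 - 1, by
    have := magicEmperorSquare_pos a c.1 c.2
    have := magicEmperorSquare_le a c.1 c.2
    omega⟩
  left_inv := by revert a; decide
  right_inv := by revert a; decide

theorem cellNum_magicEmperorTour (a : Fin 3) (i : Fin 4) (j : Fin 6) :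
    cellNum (magicEmperorTour a) (i, j) = magicEmperorSquare a i j :=
  Nat.sub_add_cancel (magicEmperorSquare_pos a i j)

theorem magicEmperorTour_injective : Function.Injective magicEmperorTour := by
  intro a b h
  have hp : magicEmperorPath a 2 = magicEmperorPath b 2 ∧
      magicEmperorPath a 4 = magicEmperorPath b 4 :=
    ⟨DFunLike.congr_fun h 2, DFunLike.congr_fun h 4⟩
  clear h
  revert a b
  decide

theorem isEmperorTour_magicEmperorTour (a : Fin 3) :
    IsEmperorTour 4 6 (magicEmperorTour a) := by
  intro k hk
  have step : ∀ (a : Fin 3) (k : Fin 23),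
      emperorMove (magicEmperorPath a k.castSucc) (magicEmperorPath a k.succ) := by
    unfold emperorMove knightMove wazirMove
    decide
  exact step a ⟨k, by omega⟩

theorem rowSum_magicEmperorTour (a : Fin 3) (i : Fin 4) :
    rowSum (magicEmperorTour a) i = 75 := by
  simp only [rowSum, cellNum_magicEmperorTour]
  revert a i; decide

theorem colSum_magicEmperorTour (a : Fin 3) (j : Fin 6) :
    colSum (magicEmperorTour a) j = 50 := by
  simp only [colSum, cellNum_magicEmperorTour]
  revert a j; decide

/-- There exist at least 3 pairwise distinct magic emperor tours of the 4×6
board: every 6-cell line (row) sums to 75 and every 4-cell line (column) sums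
to 50. -/
theorem three_magic_emperor_tours_4x6 :
    ∃ f : Fin 3 → (Fin (4 * 6) ≃ Fin 4 × Fin 6), Function.Injective f ∧
      ∀ a : Fin 3, IsEmperorTour 4 6 (f a) ∧
        (∀ i : Fin 4, rowSum (f a) i = 75) ∧
        (∀ j : Fin 6, colSum (f a) j = 50) := by
  exact ⟨magicEmperorTour, magicEmperorTour_injective, fun a =>
    ⟨isEmperorTour_magicEmperorTour a, rowSum_magicEmperorTour a,
      colSum_magicEmperorTour a⟩⟩
end

section
/- There exist at least 6 pairwise distinct emperor tours of the 4×6 board in which each of the four 6-cell lines sums to 75 (while the 4-cell lines need not be magic). -/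
/-- The tour that visits the cells in the order given by a bijective numbering, starting at 0. -/
noncomputable def tourOfNumbering {m n : ℕ} (A : Fin m × Fin n → Fin (m * n))
    (hA : Function.Bijective A) : Fin (m * n) ≃ Fin m × Fin n :=
  (Equiv.ofBijective A hA).symm

@[simp]
theorem tourOfNumbering_symm_apply {m n : ℕ} (A : Fin m × Fin n → Fin (m * n))
    (hA : Function.Bijective A) (c : Fin m × Fin n) :
    (tourOfNumbering A hA).symm c = A c :=
  rfl

theorem rowSum_tourOfNumbering {m n : ℕ} (A : Fin m × Fin n → Fin (m * n))
    (hA : Function.Bijective A) (i : Fin m) :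
    rowSum (tourOfNumbering A hA) i = ∑ j : Fin n, ((A (i, j)).val + 1) :=
  rfl

theorem isEmperorTour_tourOfNumbering {m n : ℕ} (A : Fin m × Fin n → Fin (m * n))
    (hA : Function.Bijective A)
    (h : ∀ c d, (A d).val = (A c).val + 1 → emperorMove c d) :
    IsEmperorTour m n (tourOfNumbering A hA) := by
  intro k hk
  apply h
  simp only [← tourOfNumbering_symm_apply A hA, Equiv.symm_apply_apply]

instance {m n : ℕ} (a b : Fin m × Fin n) : Decidable (emperorMove a b) := by
  unfold emperorMove knightMove wazirMove
  infer_instance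

/-- Six numberings of the 4×6 board by 0,…,23, pairwise inequivalent under the symmetries of the
board and reversal. -/
def sixBoards : Fin 6 → Fin 4 → Fin 6 → Fin (4 * 6) :=
  ![
    ![![22, 23, 12, 9, 2, 1],
      ![21, 18, 13, 10, 7, 0],
      ![14, 17, 16, 11, 8, 3],
      ![19, 20, 15, 6, 5, 4]],
    ![![2, 3, 0, 23, 20, 21],
      ![1, 8, 11, 22, 13, 14],
      ![4, 7, 10, 19, 12, 17],
      ![5, 6, 9, 16, 15, 18]],
    ![![19, 18, 17, 6, 5, 4],
      ![20, 15, 12, 11, 8, 3],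
      ![13, 16, 21, 10, 7, 2],
      ![14, 23, 22, 9, 0, 1]],
    ![![22, 23, 12, 9, 2, 1],
      ![13, 18, 21, 10, 7, 0],
      ![16, 17, 14, 11, 8, 3],
      ![19, 20, 15, 6, 5, 4]],
    ![![23, 22, 13, 10, 1, 0],
      ![14, 21, 12, 11, 6, 5],
      ![17, 18, 15, 8, 9, 2],
      ![20, 19, 16, 7, 4, 3]],
    ![![1, 2, 9, 12, 23, 22],
      ![0, 7, 10, 15, 16, 21],
      ![3, 8, 11, 14, 13, 20],
      ![4, 5, 6, 17, 18, 19]]]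

/-- The board `sixBoards a` as a numbering of cells. -/
def sixNumberings (a : Fin 6) (c : Fin 4 × Fin 6) : Fin (4 * 6) :=
  sixBoards a c.1 c.2

theorem sixNumberings_bijective (a : Fin 6) : Function.Bijective (sixNumberings a) := by
  rw [Fintype.bijective_iff_injective_and_card]
  exact ⟨by revert a; decide +kernel, by simp⟩

theorem sixNumberings_injective : Function.Injective sixNumberings := by
  decide +kernel

theorem emperorMove_of_sixNumberings_eq_add_one : ∀ (a : Fin 6) (c d : Fin 4 × Fin 6),
    (sixNumberings a d).val = (sixNumberings a c).val + 1 → emperorMove c d := by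
  decide +kernel

theorem sum_row_sixNumberings : ∀ (a : Fin 6) (i : Fin 4),
    ∑ j : Fin 6, ((sixNumberings a (i, j)).val + 1) = 75 := by
  decide +kernel

/-- There exist at least 6 pairwise distinct emperor tours of the 4×6 board in
which each of the four 6-cell lines (rows) sums to 75. -/
theorem six_emperor_tours_4x6_rows_magic :
    ∃ f : Fin 6 → (Fin (4 * 6) ≃ Fin 4 × Fin 6), Function.Injective f ∧
      ∀ a : Fin 6, IsEmperorTour 4 6 (f a) ∧
        ∀ i : Fin 4, rowSum (f a) i = 75 := by
  refine ⟨fun a => tourOfNumbering (sixNumberings a) (sixNumberings_bijective a),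
    fun a b hab => sixNumberings_injective ?_, fun a => ⟨?_, fun i => ?_⟩⟩
  · funext c
    exact congrArg (fun t => t.symm c) hab
  · exact isEmperorTour_tourOfNumbering _ _ (emperorMove_of_sixNumberings_eq_add_one a)
  · rw [rowSum_tourOfNumbering, sum_row_sixNumberings]
end
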